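/- arXiv:2302.06017 — 3 statements merged into one kernel-verified Lean document; each statement's English description precedes it below -/
import Mathlib

section
/- For all non-negative integers L and all q, one has the polynomial identity \(\sum_{m,n\ge 0} \frac{q^{2m^2+6mn+6n^2}(q;q)_L}{(q;q)_{L-3n-2m}\,(q;q)_m\,(q^3;q^3)_n} = \sum_{j=-L}^{L} \left(\frac{j+1}{3}\right) q^{j^2} \binom{2L}{L-j}_q\), where on the left the convention \(1/(q;q)_k = 0\) for negative integers k makes the sum finite. -/
open Finset

/-- The finite q-Pochhammer symbol `(a;q)_n`. -/
noncomputable def qPoch (a q : RatFunc ℚ) (n : ℕ) : RatFunc ℚ :=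
  ∏ k ∈ Finset.range n, (1 - a * q ^ k)

/-- The q-binomial coefficient `[top choose bot]_q`, zero unless `0 ≤ bot ≤ top`. -/
noncomputable def qBinom (q : RatFunc ℚ) (top bot : ℤ) : RatFunc ℚ :=
  if 0 ≤ bot ∧ bot ≤ top then
    qPoch q q top.toNat / (qPoch q q bot.toNat * qPoch q q (top - bot).toNat)
  else 0

/-- The Legendre symbol modulo 3. -/
def leg3 (j : ℤ) : ℤ := if j % 3 = 1 then 1 else if j % 3 = 2 then -1 else 0

/-- `1/(q;q)_k`, with the convention that it is zero for negative `k`. -/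
noncomputable def invPoch (q : RatFunc ℚ) (k : ℤ) : RatFunc ℚ :=
  if 0 ≤ k then (qPoch q q k.toNat)⁻¹ else 0

/-- The generic variable `q` in the field of rational functions. -/
noncomputable def Xq : RatFunc ℚ := RatFunc.X

namespace BU

variable {K : Type*} [Field K]

noncomputable def gP (q : K) (n : ℕ) : K := ∏ k ∈ range n, (1 - q * q ^ k)

noncomputable def gU (q : K) (k : ℤ) : K := if 0 ≤ k then (gP q k.toNat)⁻¹ else 0

noncomputable def gB (q : K) (a : ℕ) (k : ℤ) : K := gP q a * gU q k * gU q (a - k)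

lemma gP_ne {q : K} (hq : ∀ n : ℕ, q ^ (n + 1) ≠ 1) (n : ℕ) : gP q n ≠ 0 := by
  unfold gP
  refine Finset.prod_ne_zero_iff.mpr fun k _ h => hq k ?_
  rw [pow_succ']; exact (sub_eq_zero.mp h).symm

lemma gP_succ (q : K) (n : ℕ) : gP q (n + 1) = gP q n * (1 - q ^ (n + 1)) := by
  unfold gP
  rw [Finset.prod_range_succ, pow_succ']

lemma gU_neg (q : K) {k : ℤ} (h : k < 0) : gU q k = 0 := by
  simp [gU, not_le.mpr h]

lemma gU_nat (q : K) (k : ℕ) : gU q k = (gP q k)⁻¹ := by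
  simp [gU]

lemma gU_pred {q : K} (hq : ∀ n : ℕ, q ^ (n + 1) ≠ 1) (k : ℤ) :
    gU q (k - 1) = (1 - q ^ k) * gU q k := by
  rcases lt_trichotomy k 0 with h | h | h
  · rw [gU_neg q h, gU_neg q (by omega)]; simp
  · subst h; rw [gU_neg q (by omega)]; simp
  · obtain ⟨n, rfl⟩ : ∃ n : ℕ, k = (n : ℤ) + 1 := ⟨(k - 1).toNat, by omega⟩
    have e : (n : ℤ) + 1 = ((n + 1 : ℕ) : ℤ) := by push_cast; rfl
    rw [add_sub_cancel_right, e, gU_nat, gU_nat, gP_succ, zpow_natCast]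
    have h1 : (1 - q ^ (n + 1)) ≠ 0 := fun h => hq n (sub_eq_zero.mp h).symm
    have h2 := gP_ne hq n
    field_simp

lemma gB_pascal {q : K} (h0 : q ≠ 0) (hq : ∀ n : ℕ, q ^ (n + 1) ≠ 1) (a : ℕ) (k : ℤ) :
    gB q (a + 1) k = gB q a (k - 1) + q ^ k * gB q a k := by
  unfold gB
  have e1 : ((a + 1 : ℕ) : ℤ) - k = (a : ℤ) - (k - 1) := by push_cast; ring
  have e2 : (a : ℤ) - k = ((a : ℤ) - (k - 1)) - 1 := by ring
  rw [e1, e2, gU_pred hq k, gU_pred hq ((a : ℤ) - (k - 1)), gP_succ]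
  have e3 : q ^ (a + 1) = q ^ k * q ^ ((a : ℤ) - (k - 1)) := by
    rw [← zpow_add₀ h0, ← zpow_natCast]; congr 1; push_cast; ring
  rw [e3]; ring

lemma vand {q : K} (h0 : q ≠ 0) (hq : ∀ n : ℕ, q ^ (n + 1) ≠ 1) (B : ℕ → ℤ → K)
    (hB : ∀ a b, B (a + 1) b = B a (b - 1) + q ^ b * B a b) (a : ℕ) (b : ℤ) :
    B a b = ∑ k ∈ range (a + 1), gB q a k * q ^ (((a : ℤ) - k) * (b - k)) * B 0 (b - k) := by
  induction a generalizing b with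
  | zero => simp [gB, gU, gP]
  | succ a ih =>
    have h1 : ∑ k ∈ range (a + 1 + 1), gB q (a + 1) k *
          q ^ ((((a + 1 : ℕ) : ℤ) - k) * (b - k)) * B 0 (b - k)
        = ∑ k ∈ range (a + 1 + 1), gB q a ((k : ℤ) - 1) *
          q ^ ((((a + 1 : ℕ) : ℤ) - k) * (b - k)) * B 0 (b - k)
        + ∑ k ∈ range (a + 1 + 1), q ^ b * (gB q a k *
          q ^ (((a : ℤ) - k) * (b - k)) * B 0 (b - k)) := by
      rw [← Finset.sum_add_distrib]
      refine Finset.sum_congr rfl fun k _ => ?_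
      rw [gB_pascal h0 hq]
      have e : ((((a + 1 : ℕ) : ℤ) - k) * (b - k)) = ((a : ℤ) - k) * (b - k) + b + -k := by
        push_cast; ring
      have e' : q ^ ((((a + 1 : ℕ) : ℤ) - k) * (b - k)) * q ^ (k : ℤ)
          = q ^ (((a : ℤ) - k) * (b - k)) * q ^ b := by
        rw [← zpow_add₀ h0, ← zpow_add₀ h0]; congr 1; rw [e]; ring
      linear_combination (gB q a k * B 0 (b - k)) * e'
    rw [h1, hB, Finset.sum_range_succ', Finset.sum_range_succ _ (a + 1), ih b, ih (b - 1),
      ← Finset.mul_sum]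
    have z1 : gB q a (((0 : ℕ) : ℤ) - 1) = 0 := by
      unfold gB; rw [gU_neg q (k := ((0 : ℕ) : ℤ) - 1) (by simp)]; simp
    have z2 : gB q a ((a + 1 : ℕ) : ℤ) = 0 := by
      unfold gB; rw [gU_neg q (k := (a : ℤ) - ((a + 1 : ℕ) : ℤ)) (by push_cast; omega)]; simp
    rw [z1, z2]
    simp only [zero_mul, mul_zero, add_zero]
    congr 1
    refine Finset.sum_congr rfl fun k _ => ?_
    push_cast
    have a1 : (k : ℤ) + 1 - 1 = k := by ring
    have a2 : b - ((k : ℤ) + 1) = b - 1 - k := by ring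
    have a3 : (a : ℤ) + 1 - ((k : ℤ) + 1) = a - k := by ring
    rw [a1, a2, a3]

lemma PU {q : K} (hq : ∀ n : ℕ, q ^ (n + 1) ≠ 1) (n : ℕ) : gP q n * gU q n = 1 := by
  rw [gU_nat]; exact mul_inv_cancel₀ (gP_ne hq n)

lemma ext_range {f : ℕ → K} {M N : ℕ} (h : M ≤ N) (hf : ∀ a, M ≤ a → f a = 0) :
    ∑ a ∈ range N, f a = ∑ a ∈ range M, f a := by
  symm
  refine Finset.sum_subset (Finset.range_subset_range.mpr h) fun x _ hx => hf x ?_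
  simpa using hx

lemma shift_range {f : ℕ → K} (N k : ℕ) (h1 : ∀ a, a < k → f a = 0) (h2 : ∀ a, N ≤ a → f a = 0) :
    ∑ a ∈ range N, f a = ∑ a ∈ range N, f (a + k) := by
  rw [← ext_range (f := f) (Nat.le_add_right N k) h2, Nat.add_comm N k, Finset.sum_range_add,
    Finset.sum_eq_zero (fun a ha => h1 a (Finset.mem_range.mp ha)), zero_add]
  exact Finset.sum_congr rfl fun a _ => by rw [Nat.add_comm]

lemma diag_range {h : ℕ → ℕ → K} (N : ℕ) (hh : ∀ a b, N ≤ a + b → h a b = 0) :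
    ∑ a ∈ range N, ∑ b ∈ range N, h a b
      = ∑ s ∈ range N, ∑ p ∈ antidiagonal s, h p.1 p.2 := by
  have := Finset.sum_range_diag_flip N h
  rw [Finset.sum_congr rfl fun s _ =>
    Finset.Nat.sum_antidiagonal_eq_sum_range_succ h s, this]
  refine Finset.sum_congr rfl fun a _ => ?_
  exact ext_range (Nat.sub_le N a) fun b hb => hh a b (by omega)

lemma S1 {q : K} (h0 : q ≠ 0) (hq : ∀ n : ℕ, q ^ (n + 1) ≠ 1) (L : ℕ) (j : ℤ) :
    gB q (2 * L) (L - j) = ∑ k ∈ range (L + 1),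
      gB q L k * gB q L (k + j) * q ^ ((k : ℤ) * (k + j)) := by
  have h := vand h0 hq (fun a b => gB q (L + a) b) (fun a b => gB_pascal h0 hq (L + a) b) L (L + j)
  have e : gB q (2 * L) (L - j) = gB q (L + L) (L + j) := by
    unfold gB
    have : (((L + L : ℕ) : ℤ) - (L + j)) = L - j := by push_cast; ring
    rw [this]
    have : (((2 * L : ℕ) : ℤ) - (L - j)) = L + j := by push_cast; ring
    rw [this, two_mul]; ring
  rw [e]
  refine h.trans ?_
  rw [← Finset.sum_range_reflect]
  refine Finset.sum_congr rfl fun k hk => ?_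
  have hk' : k ≤ L := by simpa [Nat.lt_succ_iff] using hk
  have c : ((L + 1 - 1 - k : ℕ) : ℤ) = L - k := by omega
  rw [c]
  have a1 : (L : ℤ) - (L - k) = k := by ring
  have a2 : (L : ℤ) + j - (L - k) = k + j := by ring
  have a3 : gB q L ((L : ℤ) - k) = gB q L k := by
    unfold gB; rw [a1]; ring
  rw [a1, a2, a3, add_zero]; ring

lemma S3 {q : K} (h0 : q ≠ 0) (hq : ∀ n : ℕ, q ^ (n + 1) ≠ 1) (L k : ℕ) (hk : k ≤ L) (l : ℤ) :
    gB q L k * gB q L l = ∑ c ∈ range (L + 1), gP q L * q ^ (((k : ℤ) - c) * (l - c)) *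
      gU q c * gU q (k - c) * gU q (l - c) * gU q (L - k - l + c) := by
  have h := vand h0 hq (fun a b => gB q (L - k + a) b)
    (fun a b => gB_pascal h0 hq (L - k + a) b) k l
  simp only [Nat.sub_add_cancel hk, add_zero] at h
  rw [h, ext_range (M := k + 1) (N := L + 1) (by omega), Finset.mul_sum]
  · refine Finset.sum_congr rfl fun c _ => ?_
    unfold gB
    have e : (((L - k : ℕ) : ℤ) - (l - c)) = L - k - l + c := by
      rw [Nat.cast_sub hk]; ring
    have e2 : ((L : ℤ) - k) = ((L - k : ℕ) : ℤ) := by rw [Nat.cast_sub hk]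
    rw [e, e2]
    linear_combination (gP q L * q ^ (((k : ℤ) - c) * (l - c)) *
      gU q c * gU q (k - c) * gU q (l - c) * gU q (((L - k : ℕ) : ℤ) - l + c)) *
      (gP q (L - k) * gU q ((L - k : ℕ) : ℤ) * PU hq k + PU hq (L - k))
  · intro a ha
    rw [gU_neg q (k := (k : ℤ) - a) (by omega)]; simp

lemma S5 {q : K} (h0 : q ≠ 0) (hq : ∀ n : ℕ, q ^ (n + 1) ≠ 1) (L a : ℕ) (ha : a ≤ L) (b : ℤ) :
    gU q a * gU q b = ∑ k ∈ range (L + 1), q ^ (((a : ℤ) - k) * (b - k)) *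
      gU q k * gU q (a - k) * gU q (b - k) := by
  have h := vand h0 hq (fun _ b => gU q b) (fun a b => by rw [gU_pred hq]; ring) a b
  rw [h, ext_range (M := a + 1) (N := L + 1) (by omega), Finset.mul_sum]
  · refine Finset.sum_congr rfl fun c _ => ?_
    unfold gB
    linear_combination (q ^ (((a : ℤ) - c) * (b - c)) *
      gU q c * gU q (a - c) * gU q (b - c)) * PU hq a
  · intro k hk
    rw [gU_neg q (k := (a : ℤ) - k) (by omega)]; simp

lemma S2 {q : K} (h0 : q ≠ 0) (hq : ∀ n : ℕ, q ^ (n + 1) ≠ 1) (w : ℤ → K) (L : ℕ) :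
    ∑ j ∈ Finset.Icc (-(L : ℤ)) (L : ℤ), w j * q ^ (j ^ 2) * gB q (2 * L) (L - j)
    = ∑ k ∈ range (L + 1), ∑ l ∈ range (L + 1),
      w ((l : ℤ) - k) * q ^ (((l : ℤ) - k) ^ 2 + k * l) * (gB q L k * gB q L l) := by
  simp_rw [S1 h0 hq, Finset.mul_sum]
  rw [Finset.sum_comm]
  refine Finset.sum_congr rfl fun k hk => ?_
  have hk' : k ≤ L := by simpa [Nat.lt_succ_iff] using hk
  symm
  refine Finset.sum_of_injOn (fun l : ℕ => (l : ℤ) - k) ?_ ?_ ?_ ?_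
  · intro a _ b _ h; simp only at h; omega
  · intro l hl; simp at hl ⊢; omega
  · intro j hj hj'
    have : (k : ℤ) + j < 0 ∨ (L : ℤ) - (k + j) < 0 := by
      by_contra hc
      push Not at hc
      apply hj'
      refine ⟨((k : ℤ) + j).toNat, ?_, ?_⟩
      · simp; omega
      · simp; omega
    unfold gB
    rcases this with h | h <;> rw [gU_neg q h] <;> simp
  · intro l _
    have e : (k : ℤ) + ((l : ℤ) - k) = l := by ring
    simp only [e]
    rw [zpow_add₀ h0]; ring

lemma S4 {q : K} (h0 : q ≠ 0) (hq : ∀ n : ℕ, q ^ (n + 1) ≠ 1) (w : ℤ → K) (L : ℕ) :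
    ∑ k ∈ range (L + 1), ∑ l ∈ range (L + 1),
      w ((l : ℤ) - k) * q ^ (((l : ℤ) - k) ^ 2 + k * l) * (gB q L k * gB q L l)
    = ∑ c ∈ range (L + 1), ∑ a ∈ range (L + 1), ∑ b ∈ range (L + 1),
      gP q L * w ((b : ℤ) - a) * q ^ (((b : ℤ) - a) ^ 2 + (a + c) * (b + c) + a * b) *
        gU q c * (gU q a * gU q b) * gU q (L - a - b - c) := by
  have h1 : ∀ k ∈ range (L + 1), ∀ l ∈ range (L + 1),
      w ((l : ℤ) - k) * q ^ (((l : ℤ) - k) ^ 2 + k * l) * (gB q L k * gB q L l)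
      = ∑ c ∈ range (L + 1), gP q L * w ((l : ℤ) - k) *
        q ^ (((l : ℤ) - k) ^ 2 + k * l + ((k : ℤ) - c) * (l - c)) *
        gU q c * (gU q (k - c) * gU q (l - c)) * gU q (L - k - l + c) := by
    intro k hk l _
    have hk' : k ≤ L := by simpa [Nat.lt_succ_iff] using hk
    rw [S3 h0 hq L k hk' l, Finset.mul_sum]
    refine Finset.sum_congr rfl fun c _ => ?_
    rw [zpow_add₀ h0 _ (((k : ℤ) - c) * (l - c))]; ring
  rw [Finset.sum_congr rfl fun k hk => Finset.sum_congr rfl fun l hl => h1 k hk l hl]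
  rw [Finset.sum_congr rfl fun k _ => Finset.sum_comm]
  rw [Finset.sum_comm]
  refine Finset.sum_congr rfl fun c _ => ?_
  rw [shift_range (L + 1) c]
  · refine Finset.sum_congr rfl fun a _ => ?_
    rw [shift_range (L + 1) c]
    · refine Finset.sum_congr rfl fun b _ => ?_
      push_cast
      have a1 : (b : ℤ) + c - (a + c) = b - a := by ring
      have a2 : (b : ℤ) + c - c = b := by ring
      have a3 : (a : ℤ) + c - c = a := by ring
      have a4 : (L : ℤ) - (a + c) - (b + c) + c = L - a - b - c := by ring
      rw [a1, a2, a3, a4]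
    · intro b hb; rw [gU_neg q (k := (b : ℤ) - c) (by omega)]; simp
    · intro b hb
      rw [gU_neg q (k := (L : ℤ) - ((a + c : ℕ) : ℤ) - b + c) (by push_cast; omega)]; simp
  · intro a ha
    refine Finset.sum_eq_zero fun b _ => ?_
    rw [gU_neg q (k := (a : ℤ) - c) (by omega)]; simp
  · intro a ha
    refine Finset.sum_eq_zero fun b _ => ?_
    by_cases hb : b < c
    · rw [gU_neg q (k := (b : ℤ) - c) (by omega)]; simp
    · rw [gU_neg q (k := (L : ℤ) - a - b + c) (by omega)]; simp

lemma choose_two (a : ℕ) : 2 * ((a.choose 2 : ℕ) : ℤ) = a * (a - 1) := by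
  induction a with
  | zero => simp
  | succ n ih =>
    rw [Nat.choose_succ_succ' n 1, Nat.choose_one_right]
    push_cast; linarith

noncomputable def gE (q : K) (a : ℕ) : K := q ^ (a.choose 2) * gU q a

noncomputable def gF (q : K) (L k s : ℕ) : K :=
  q ^ (2 * k ^ 2 + 2 * k * s + (s + 1).choose 2) * gU q k * gU q ((L : ℤ) - s - 2 * k)

lemma S6 {q : K} (h0 : q ≠ 0) (hq : ∀ n : ℕ, q ^ (n + 1) ≠ 1) (w : ℤ → K) (L : ℕ) :
    ∑ c ∈ range (L + 1), ∑ a ∈ range (L + 1), ∑ b ∈ range (L + 1),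
      gP q L * w ((b : ℤ) - a) * q ^ (((b : ℤ) - a) ^ 2 + (a + c) * (b + c) + a * b) *
        gU q c * (gU q a * gU q b) * gU q (L - a - b - c)
    = gP q L * ∑ k ∈ range (L + 1), ∑ c ∈ range (L + 1), ∑ a ∈ range (L + 1), ∑ b ∈ range (L + 1),
      w ((b : ℤ) - a) * (gE q a * gE q b * gE q c * gF q L k (a + b + c)) := by
  have h1 : ∀ c ∈ range (L + 1), ∀ a ∈ range (L + 1), ∀ b ∈ range (L + 1),
      gP q L * w ((b : ℤ) - a) * q ^ (((b : ℤ) - a) ^ 2 + (a + c) * (b + c) + a * b) *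
        gU q c * (gU q a * gU q b) * gU q (L - a - b - c)
      = ∑ k ∈ range (L + 1), gP q L * (w ((b : ℤ) - a) *
        q ^ (((b : ℤ) - a) ^ 2 + (a + c) * (b + c) + a * b + ((a : ℤ) - k) * (b - k)) *
        gU q c * (gU q k * gU q (a - k) * gU q (b - k)) * gU q (L - a - b - c)) := by
    intro c _ a ha b _
    have ha' : a ≤ L := by simpa [Nat.lt_succ_iff] using ha
    rw [S5 h0 hq L a ha' b, Finset.mul_sum, Finset.sum_mul]
    refine Finset.sum_congr rfl fun k _ => ?_
    rw [zpow_add₀ h0 _ (((a : ℤ) - k) * (b - k))]; ring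
  rw [Finset.sum_congr rfl fun c hc => Finset.sum_congr rfl fun a ha =>
    Finset.sum_congr rfl fun b hb => h1 c hc a ha b hb]
  rw [Finset.sum_congr rfl fun c _ => Finset.sum_congr rfl fun a _ => Finset.sum_comm]
  rw [Finset.sum_congr rfl fun c _ => Finset.sum_comm]
  rw [Finset.sum_comm, Finset.mul_sum]
  refine Finset.sum_congr rfl fun k _ => ?_
  rw [Finset.mul_sum]
  refine Finset.sum_congr rfl fun c _ => ?_
  rw [Finset.mul_sum, shift_range (L + 1) k]
  · refine Finset.sum_congr rfl fun a _ => ?_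
    rw [Finset.mul_sum, shift_range (L + 1) k]
    · refine Finset.sum_congr rfl fun b _ => ?_
      unfold gE gF
      push_cast
      have a1 : (b : ℤ) + k - (a + k) = b - a := by ring
      have a2 : (b : ℤ) + k - k = b := by ring
      have a3 : (a : ℤ) + k - k = a := by ring
      have a4 : (L : ℤ) - (a + k) - (b + k) - c = L - (a + b + c) - 2 * k := by ring
      rw [a1, a2, a3, a4]
      have hx : q ^ (((b : ℤ) - a) ^ 2 + ((a + k) + c) * ((b + k) + c) + (a + k) * (b + k) + a * b)
          = q ^ (a.choose 2) * q ^ (b.choose 2) * q ^ (c.choose 2) *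
            q ^ (2 * k ^ 2 + 2 * k * (a + b + c) + (a + b + c + 1).choose 2) := by
        rw [← pow_add, ← pow_add, ← pow_add, ← zpow_natCast]
        congr 1
        have e1 := choose_two a
        have e2 := choose_two b
        have e3 := choose_two c
        have e4 := choose_two (a + b + c + 1)
        push_cast at e4 ⊢
        linarith
      rw [hx]; ring
    · intro b hb; rw [gU_neg q (k := (b : ℤ) - k) (by omega)]; simp
    · intro b hb
      rw [gU_neg q (k := (L : ℤ) - ((a + k : ℕ) : ℤ) - b - c) (by push_cast; omega)]; simp
  · intro a ha
    refine Finset.sum_eq_zero fun b _ => ?_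
    rw [gU_neg q (k := (a : ℤ) - k) (by omega)]; simp
  · intro a ha
    refine Finset.sum_eq_zero fun b _ => ?_
    rw [gU_neg q (k := (L : ℤ) - a - b - c) (by omega)]; simp

lemma leg_zeta {z : K} (hz : z ^ 2 + z + 1 = 0) (a b : ℕ) :
    ((leg3 ((b : ℤ) - a + 1) : ℤ) : K) + ((leg3 ((a : ℤ) - b + 1) : ℤ) : K)
      = z ^ (a + 2 * b) + z ^ (b + 2 * a) := by
  have h3 : z ^ 3 = 1 := by linear_combination (z - 1) * hz
  have hm : ∀ n : ℕ, z ^ n = z ^ (n % 3) := by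
    intro n
    conv_lhs => rw [← Nat.div_add_mod n 3, pow_add, pow_mul, h3, one_pow, one_mul]
  rw [hm (a + 2 * b), hm (b + 2 * a)]
  unfold leg3
  have ha : a % 3 = 0 ∨ a % 3 = 1 ∨ a % 3 = 2 := by omega
  have hb : b % 3 = 0 ∨ b % 3 = 1 ∨ b % 3 = 2 := by omega
  have key : (b % 3 = a % 3 ∧ ((b : ℤ) - a + 1) % 3 = 1 ∧ ((a : ℤ) - b + 1) % 3 = 1 ∧
      (a + 2 * b) % 3 = 0 ∧ (b + 2 * a) % 3 = 0) ∨
      (((b : ℤ) - a + 1) % 3 = 2 ∧ ((a : ℤ) - b + 1) % 3 = 0 ∧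
      (a + 2 * b) % 3 = 2 ∧ (b + 2 * a) % 3 = 1) ∨
      (((b : ℤ) - a + 1) % 3 = 0 ∧ ((a : ℤ) - b + 1) % 3 = 2 ∧
      (a + 2 * b) % 3 = 1 ∧ (b + 2 * a) % 3 = 2) := by omega
  rcases key with ⟨_, h1, h2, h3, h4⟩ | ⟨h1, h2, h3, h4⟩ | ⟨h1, h2, h3, h4⟩ <;>
    rw [h1, h2, h3, h4] <;> norm_num <;> linear_combination -hz

lemma S7 {z : K} (h2 : (2 : K) ≠ 0) (hz : z ^ 2 + z + 1 = 0) (N : ℕ) (X : ℕ → ℕ → K)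
    (hX : ∀ a b, X a b = X b a) :
    ∑ a ∈ range N, ∑ b ∈ range N, ((leg3 ((b : ℤ) - a + 1) : ℤ) : K) * X a b
    = ∑ a ∈ range N, ∑ b ∈ range N, z ^ (a + 2 * b) * X a b := by
  apply mul_left_cancel₀ h2
  rw [two_mul, two_mul]
  nth_rewrite 2 [Finset.sum_comm]
  nth_rewrite 4 [Finset.sum_comm]
  simp only [← Finset.sum_add_distrib]
  refine Finset.sum_congr rfl fun a _ => Finset.sum_congr rfl fun b _ => ?_
  rw [hX b a, ← add_mul, ← add_mul, leg_zeta hz]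

lemma eqz {x y : K} (h : x * y = 0) (hx : x ≠ 0) : y = 0 :=
  (_root_.mul_eq_zero.mp h).resolve_left hx

open PowerSeries in
lemma S9a {q : K} (hq : ∀ n : ℕ, q ^ (n + 1) ≠ 1) :
    (PowerSeries.mk (gE q)) = (1 + PowerSeries.X) * rescale q (PowerSeries.mk (gE q)) := by
  ext n
  cases n with
  | zero =>
    rw [add_mul, one_mul, map_add, coeff_zero_X_mul, coeff_rescale]; simp
  | succ n =>
    rw [add_mul, one_mul, map_add, coeff_succ_X_mul]
    simp only [coeff_rescale, coeff_mk]
    unfold gE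
    have h := gU_pred hq ((n + 1 : ℕ) : ℤ)
    have e : ((n + 1 : ℕ) : ℤ) - 1 = n := by push_cast; ring
    rw [e, zpow_natCast] at h
    rw [h, Nat.choose_succ_succ' n 1, Nat.choose_one_right]
    ring

noncomputable def gG (q z : K) : PowerSeries K :=
  PowerSeries.mk (gE q) * (PowerSeries.rescale z (PowerSeries.mk (gE q)) *
    PowerSeries.rescale (z ^ 2) (PowerSeries.mk (gE q)))

open PowerSeries in
lemma S9b {q z : K} (hq : ∀ n : ℕ, q ^ (n + 1) ≠ 1) (hz : z ^ 2 + z + 1 = 0) :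
    gG q z = (1 + PowerSeries.X ^ 3) * rescale q (gG q z) := by
  have h3 : z ^ 3 = 1 := by linear_combination (z - 1) * hz
  unfold gG
  have e := S9a hq
  set E := PowerSeries.mk (gE q) with hE
  have e1 : ∀ y : K, rescale y E = (1 + C y * PowerSeries.X) * rescale q (rescale y E) := by
    intro y
    have h := congrArg (rescale y) e
    rw [map_mul, map_add, map_one, rescale_X, rescale_rescale] at h
    rw [rescale_rescale, mul_comm y q]
    rw [mul_comm q y] at *
    exact h
  rw [map_mul, map_mul]
  conv_lhs => rw [e1 z, e1 (z ^ 2)]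
  nth_rewrite 1 [e]
  have c1 : (C z : PowerSeries K) ^ 2 + C z + 1 = 0 := by
    rw [← map_pow, ← map_add, ← map_one (C (R := K)), ← map_add, hz, map_zero]
  rw [map_pow]
  have c2 : (1 + PowerSeries.X) * ((1 + C z * PowerSeries.X) * (1 + (C z) ^ 2 * PowerSeries.X))
      = (1 + PowerSeries.X ^ 3 : PowerSeries K) := by
    linear_combination (PowerSeries.X + PowerSeries.X ^ 2 * (C z) + PowerSeries.X ^ 3 * (C z - 1)) * c1
  rw [← c2]; ring

open PowerSeries in
lemma S9c {q z : K} (hq : ∀ n : ℕ, q ^ (n + 1) ≠ 1) (hz : z ^ 2 + z + 1 = 0) (n : ℕ) :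
    coeff (3 * n) (gG q z) = q ^ (3 * n.choose 2) * (gP (q ^ 3) n)⁻¹ ∧
    coeff (3 * n + 1) (gG q z) = 0 ∧ coeff (3 * n + 2) (gG q z) = 0 := by
  have hG := S9b hq hz
  have r1 : ∀ m, m < 3 → coeff m (gG q z) = q ^ m * coeff m (gG q z) := by
    intro m hm
    conv_lhs => rw [hG, add_mul, one_mul, map_add, coeff_X_pow_mul', if_neg (by omega), add_zero,
      coeff_rescale]
  have r2 : ∀ m, coeff (m + 3) (gG q z) = q ^ (m + 3) * coeff (m + 3) (gG q z)
      + q ^ m * coeff m (gG q z) := by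
    intro m
    conv_lhs => rw [hG, add_mul, one_mul, map_add, coeff_X_pow_mul, coeff_rescale, coeff_rescale]
  have nz : ∀ m, (1 - q ^ (m + 1)) ≠ 0 := fun m h => hq m (sub_eq_zero.mp h).symm
  induction n with
  | zero =>
    refine ⟨?_, ?_, ?_⟩
    · rw [gG, mul_zero, coeff_mul, Finset.Nat.antidiagonal_zero, sum_singleton, coeff_mul, Finset.Nat.antidiagonal_zero, sum_singleton, coeff_rescale, coeff_rescale]
      simp [gP, gE, gU]
    · have := r1 1 (by omega)
      refine eqz (x := 1 - q ^ (0 + 1)) ?_ (nz 0)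
      linear_combination this
    · have := r1 2 (by omega)
      refine eqz (x := 1 - q ^ (1 + 1)) ?_ (nz 1)
      linear_combination this
  | succ n ih =>
    obtain ⟨i0, i1, i2⟩ := ih
    have hq3 : ∀ n : ℕ, (q ^ 3) ^ (n + 1) ≠ 1 := by
      intro n; rw [← pow_mul]; exact hq (3 * n + 2)
    refine ⟨?_, ?_, ?_⟩
    · have := r2 (3 * n)
      rw [i0] at this
      apply mul_left_cancel₀ (nz (3 * n + 2))
      have h1 := gP_ne hq3 n
      have h2 : 1 - (q ^ 3) ^ (n + 1) ≠ 0 := fun h => hq3 n (sub_eq_zero.mp h).symm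
      have h3 : 1 - q ^ (3 * n + 2 + 1) = 1 - (q ^ 3) ^ (n + 1) := by rw [← pow_mul]; rfl
      have h4 : coeff (3 * (n + 1)) (gG q z) * (1 - q ^ (3 * n + 2 + 1)) =
        q ^ (3 * n) * (q ^ (3 * n.choose 2) * (gP (q ^ 3) n)⁻¹) := by
        linear_combination this
      rw [mul_comm, h4, h3, gP_succ, Nat.choose_succ_succ' n 1, Nat.choose_one_right]
      field_simp
      ring
    · have := r2 (3 * n + 1)
      rw [i1] at this
      refine eqz (x := 1 - q ^ (3 * n + 3 + 1)) ?_ (nz _)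
      linear_combination this
    · have := r2 (3 * n + 2)
      rw [i2] at this
      refine eqz (x := 1 - q ^ (3 * n + 4 + 1)) ?_ (nz _)
      linear_combination this

open PowerSeries in
lemma S8 (q z : K) (N : ℕ) (F : ℕ → K) (hF : ∀ s, N ≤ s → F s = 0) :
    ∑ c ∈ range N, ∑ a ∈ range N, ∑ b ∈ range N,
      z ^ (a + 2 * b) * (gE q a * gE q b * gE q c * F (a + b + c))
    = ∑ s ∈ range N, F s * coeff s (gG q z) := by
  have h1 : ∀ c ∈ range N, ∑ a ∈ range N, ∑ b ∈ range N,
      z ^ (a + 2 * b) * (gE q a * gE q b * gE q c * F (a + b + c))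
      = ∑ t ∈ range N, gE q c * coeff t (PowerSeries.rescale z (PowerSeries.mk (gE q)) *
    PowerSeries.rescale (z ^ 2) (PowerSeries.mk (gE q))) * F (c + t) := by
    intro c _
    rw [diag_range]
    · refine Finset.sum_congr rfl fun t _ => ?_
      rw [coeff_mul, Finset.mul_sum, Finset.sum_mul]
      refine Finset.sum_congr rfl fun p hp => ?_
      rw [HasAntidiagonal.mem_antidiagonal] at hp
      simp only [coeff_rescale, coeff_mk]
      rw [← hp, Nat.add_comm c, pow_add, pow_mul]; ring
    · intro a b hab; rw [hF _ (by omega)]; simp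
  rw [Finset.sum_congr rfl h1, diag_range]
  · refine Finset.sum_congr rfl fun s _ => ?_
    rw [gG, coeff_mul, Finset.mul_sum]
    refine Finset.sum_congr rfl fun p hp => ?_
    rw [HasAntidiagonal.mem_antidiagonal] at hp
    rw [coeff_mk, hp]; ring
  · intro a b hab; rw [hF _ (by omega)]; simp

lemma sum_three (f : ℕ → K) (h1 : ∀ n, f (3 * n + 1) = 0) (h2 : ∀ n, f (3 * n + 2) = 0) (N : ℕ) :
    ∑ s ∈ range (3 * N), f s = ∑ n ∈ range N, f (3 * n) := by
  induction N with
  | zero => simp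
  | succ N ih =>
    rw [show 3 * (N + 1) = 3 * N + 1 + 1 + 1 by ring, Finset.sum_range_succ, Finset.sum_range_succ,
      Finset.sum_range_succ, ih, Finset.sum_range_succ, h1, h2]; ring

theorem main {q z : K} (h0 : q ≠ 0) (hq : ∀ n : ℕ, q ^ (n + 1) ≠ 1) (hc : (2 : K) ≠ 0)
    (hz : z ^ 2 + z + 1 = 0) (L : ℕ) :
    ∑ m ∈ Finset.range (L + 1), ∑ n ∈ Finset.range (L + 1),
      q ^ (2 * m ^ 2 + 6 * m * n + 6 * n ^ 2) * gP q L *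
        gU q ((L : ℤ) - 3 * n - 2 * m) *
        (gP q m * gP (q ^ 3) n)⁻¹ =
    ∑ j ∈ Finset.Icc (-(L : ℤ)) (L : ℤ),
      ((leg3 (j + 1) : ℤ) : K) * q ^ (j ^ 2) * gB q (2 * L) ((L : ℤ) - j) := by
  rw [S2 h0 hq (fun j => ((leg3 (j + 1) : ℤ) : K)), S4 h0 hq (fun j => ((leg3 (j + 1) : ℤ) : K)),
    S6 h0 hq (fun j => ((leg3 (j + 1) : ℤ) : K)), Finset.mul_sum]
  refine Finset.sum_congr rfl fun k _ => ?_
  have hF : ∀ s, L + 1 ≤ s → gF q L k s = 0 := by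
    intro s hs; unfold gF; rw [gU_neg q (k := (L : ℤ) - s - 2 * k) (by omega)]; simp
  rw [Finset.sum_congr rfl fun c _ => S7 hc hz (L + 1)
    (fun a b => gE q a * gE q b * gE q c * gF q L k (a + b + c))
    (fun a b => by rw [Nat.add_comm a b]; ring)]
  rw [S8 q z (L + 1) (gF q L k) hF]
  rw [← ext_range (f := fun s => gF q L k s * PowerSeries.coeff s (gG q z)) (N := 3 * (L + 1)) (by omega)
    (fun s hs => by rw [hF s hs]; simp)]
  rw [sum_three (fun s => gF q L k s * PowerSeries.coeff s (gG q z)) (fun n => by rw [(S9c hq hz n).2.1]; simp)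
    (fun n => by rw [(S9c hq hz n).2.2]; simp), Finset.mul_sum]
  refine Finset.sum_congr rfl fun n _ => ?_
  rw [(S9c hq hz n).1]
  unfold gF
  rw [gU_nat, mul_inv]
  have hx : q ^ (2 * k ^ 2 + 6 * k * n + 6 * n ^ 2) =
      q ^ (2 * k ^ 2 + 2 * k * (3 * n) + (3 * n + 1).choose 2) * q ^ (3 * n.choose 2) := by
    rw [← pow_add]
    congr 1
    have e1 := choose_two n
    have e2 := choose_two (3 * n + 1)
    zify
    push_cast at e2
    linarith
  rw [hx]
  push_cast
  ring

end BU

/-- Theorem 1.1 (Berkovich–Uncu): for all `L ≥ 0`,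
`∑_{m,n≥0} q^{2m²+6mn+6n²} (q;q)_L / ((q;q)_{L-3n-2m} (q;q)_m (q³;q³)_n)
  = ∑_{j=-L}^{L} ((j+1)/3) q^{j²} [2L choose L-j]_q`,
as an identity of rational functions in `q`. -/
theorem statement0 (L : ℕ) :
    ∑ m ∈ Finset.range (L + 1), ∑ n ∈ Finset.range (L + 1),
      Xq ^ (2 * m ^ 2 + 6 * m * n + 6 * n ^ 2) * qPoch Xq Xq L *
        invPoch Xq ((L : ℤ) - 3 * n - 2 * m) *
        (qPoch Xq Xq m * qPoch (Xq ^ 3) (Xq ^ 3) n)⁻¹ =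
    ∑ j ∈ Finset.Icc (-(L : ℤ)) (L : ℤ),
      (leg3 (j + 1) : RatFunc ℚ) * Xq ^ (j ^ 2) * qBinom Xq (2 * L) ((L : ℤ) - j) := by
  set f := algebraMap (RatFunc ℚ) (AlgebraicClosure (RatFunc ℚ)) with hf
  have finj : Function.Injective f := f.injective
  have h0 : Xq ≠ 0 := RatFunc.X_ne_zero
  have hq : ∀ n : ℕ, Xq ^ (n + 1) ≠ 1 := by
    intro n h
    have h' : (algebraMap (Polynomial ℚ) (RatFunc ℚ)) (Polynomial.X ^ (n + 1)) =
        algebraMap (Polynomial ℚ) (RatFunc ℚ) 1 := by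
      rw [map_pow, RatFunc.algebraMap_X, map_one]; exact h
    have h2 := RatFunc.algebraMap_injective ℚ h'
    have h3 := congrArg Polynomial.natDegree h2
    simp at h3
  obtain ⟨r, hr⟩ := IsAlgClosed.exists_pow_nat_eq (-3 : AlgebraicClosure (RatFunc ℚ))
    (n := 2) (by norm_num)
  have hz : ((r - 1) / 2) ^ 2 + (r - 1) / 2 + 1 = 0 := by
    field_simp; linear_combination hr
  have fP : ∀ (x : RatFunc ℚ) n, f (qPoch x x n) = BU.gP (f x) n := by
    intro x n; simp [qPoch, BU.gP]
  have fU : ∀ k, f (invPoch Xq k) = BU.gU (f Xq) k := by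
    intro k; unfold invPoch BU.gU; split_ifs <;> simp [fP]
  have fB : ∀ j ∈ Finset.Icc (-(L : ℤ)) (L : ℤ), f (qBinom Xq (2 * L) ((L : ℤ) - j))
      = BU.gB (f Xq) (2 * L) ((L : ℤ) - j) := by
    intro j hj
    rw [Finset.mem_Icc] at hj
    unfold qBinom BU.gB BU.gU
    rw [if_pos (by omega), if_pos (by omega), if_pos (by push_cast; omega)]
    rw [map_div₀, map_mul, fP, fP, fP]
    have : (2 * (L : ℤ)).toNat = 2 * L := by omega
    rw [this]; push_cast
    rw [div_eq_mul_inv, mul_inv]; ring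
  have M := BU.main (q := f Xq) (z := (r - 1) / 2) (by simpa using h0)
    (fun n h => hq n (finj (by rw [map_pow, h, map_one]))) two_ne_zero hz L
  apply finj
  rw [map_sum, map_sum]
  refine Eq.trans ?_ (M.trans ?_)
  · refine Finset.sum_congr rfl fun m _ => ?_
    rw [map_sum]
    refine Finset.sum_congr rfl fun n _ => ?_
    simp only [map_mul, map_inv₀, map_pow, fP, fU]
  · refine Finset.sum_congr rfl fun j hj => ?_
    rw [map_mul, map_mul, fB j hj, map_intCast, map_zpow₀]
end

section
/- For every non-negative integer L, \(\sum_{j=-\infty}^{\infty} (-1)^j q^{j^2} \left(\frac{j+1}{3}\right) \binom{2L}{L+j}_{q^2} = \frac{(q^3;q^6)_L}{(q;q^2)_L}\). The sum is finite since the q-binomial coefficient vanishes for |j| > L. -/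
open Finset

lemma Xq_ne : Xq ≠ 0 := RatFunc.X_ne_zero

lemma Xq_pow_ne (n : ℕ) (hn : n ≠ 0) : (1 : RatFunc ℚ) - Xq ^ n ≠ 0 := by
  intro h
  have h1 : (Xq : RatFunc ℚ) ^ n = 1 := (sub_eq_zero.mp h).symm
  have h2 : algebraMap (Polynomial ℚ) (RatFunc ℚ) (Polynomial.X ^ n)
      = algebraMap (Polynomial ℚ) (RatFunc ℚ) 1 := by
    rw [map_pow, RatFunc.algebraMap_X, map_one]; exact h1
  have h3 := RatFunc.algebraMap_injective ℚ h2
  have h4 := congrArg Polynomial.natDegree h3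
  simp at h4
  exact hn h4

lemma qPoch_succ (a q : RatFunc ℚ) (n : ℕ) :
    qPoch a q (n + 1) = qPoch a q n * (1 - a * q ^ n) := by
  simp [qPoch, Finset.prod_range_succ]

lemma qPoch_zero (a q : RatFunc ℚ) : qPoch a q 0 = 1 := by simp [qPoch]

lemma P_ne (n : ℕ) : qPoch (Xq ^ 2) (Xq ^ 2) n ≠ 0 := by
  unfold qPoch
  refine Finset.prod_ne_zero_iff.mpr fun k _ => ?_
  have := Xq_pow_ne (2 * (k + 1)) (by omega)
  rwa [← pow_succ', ← pow_mul]

lemma O_ne (n : ℕ) : qPoch Xq (Xq ^ 2) n ≠ 0 := by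
  unfold qPoch
  refine Finset.prod_ne_zero_iff.mpr fun k _ => ?_
  have := Xq_pow_ne (2 * k + 1) (by omega)
  rwa [← pow_mul, ← pow_succ']

lemma qBinom_nat (p : RatFunc ℚ) (a b : ℕ) (n k : ℤ) (hn : n = a + b) (hk : k = a) :
    qBinom p n k = qPoch p p (a + b) / (qPoch p p a * qPoch p p b) := by
  subst hn hk
  have h : (0 : ℤ) ≤ a ∧ (a : ℤ) ≤ a + b := by omega
  rw [qBinom, if_pos h]
  have h1 : ((a : ℤ) + b).toNat = a + b := by omega
  have h2 : ((a : ℤ) + b - a).toNat = b := by omega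
  rw [h1, h2, Int.toNat_natCast]

lemma qBinom_out (p : RatFunc ℚ) (n k : ℤ) (h : ¬ (0 ≤ k ∧ k ≤ n)) : qBinom p n k = 0 := by
  rw [qBinom, if_neg h]

lemma pascal (n : ℕ) (k : ℤ) :
    qBinom (Xq ^ 2) (n + 1) k
      = qBinom (Xq ^ 2) n (k - 1) + (Xq ^ 2) ^ k * qBinom (Xq ^ 2) n k ∧
    qBinom (Xq ^ 2) (n + 1) k
      = (Xq ^ 2) ^ ((n : ℤ) + 1 - k) * qBinom (Xq ^ 2) n (k - 1) + qBinom (Xq ^ 2) n k := by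
  have hP := P_ne
  generalize Xq ^ 2 = p at *
  by_cases h0 : k < 0
  · rw [qBinom_out _ _ _ (by omega), qBinom_out _ _ _ (by omega), qBinom_out _ _ _ (by omega)]
    simp
  by_cases h1 : (n : ℤ) + 1 < k
  · rw [qBinom_out _ _ _ (by omega), qBinom_out _ _ _ (by omega), qBinom_out _ _ _ (by omega)]
    simp
  by_cases h2 : k = 0
  · subst h2
    rw [qBinom_nat p 0 (n + 1) ((n : ℤ) + 1) 0 (by push_cast; ring) rfl, qBinom_out p n (0 - 1) (by omega),
      qBinom_nat p 0 n (n : ℤ) 0 (by simp) rfl]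
    simp [qPoch_zero, hP]
  by_cases h3 : k = n + 1
  · subst h3
    rw [qBinom_nat p (n + 1) 0 _ _ (by simp) (by simp), qBinom_out p n (n + 1) (by omega),
      qBinom_nat p n 0 _ _ (by simp) (by simp)]
    simp [qPoch_zero, hP]
  obtain ⟨a, ha⟩ : ∃ a : ℕ, k = a + 1 := ⟨(k - 1).toNat, by omega⟩
  obtain ⟨b, hb⟩ : ∃ b : ℕ, n = a + 1 + b := ⟨n - a - 1, by omega⟩
  subst ha hb
  rw [qBinom_nat p (a + 1) (b + 1) _ _ (by push_cast; ring) (by simp),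
    qBinom_nat p a (b + 1) _ _ (by push_cast; ring) (by simp),
    qBinom_nat p (a + 1) b _ _ (by push_cast; ring) (by simp)]
  have e1 : (((a + 1 + b : ℕ) : ℤ) + 1 - (a + 1)) = ((b + 1 : ℕ) : ℤ) := by push_cast; ring
  have e2 : ((a : ℤ) + 1) = ((a + 1 : ℕ) : ℤ) := by push_cast; ring
  rw [e1, e2, zpow_natCast, zpow_natCast]
  have hA := hP a
  have hB := hP b
  have hA' := hP (a + 1)
  have hB' := hP (b + 1)
  rw [show a + 1 + (b + 1) = (a + b + 1) + 1 by ring, show a + (b + 1) = a + b + 1 by ring,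
    show a + 1 + b = a + b + 1 by ring, qPoch_succ _ _ (a + b + 1)]
  generalize qPoch p p (a + b + 1) = N
  rw [qPoch_succ] at hA' hB' ⊢
  rw [qPoch_succ _ _ b]
  have hA2 := right_ne_zero_of_mul hA'
  have hB2 := right_ne_zero_of_mul hB'
  generalize qPoch p p a = A at *
  generalize qPoch p p b = B at *
  have q1 : p * p ^ a = p ^ (a + 1) := by ring
  have q2 : p * p ^ b = p ^ (b + 1) := by ring
  have q3 : p * p ^ (a + b + 1) = p ^ (a + 1) * p ^ (b + 1) := by ring
  rw [q1] at hA2 ⊢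
  rw [q2] at hB2 ⊢
  rw [q3]
  generalize p ^ (a + 1) = x at *
  generalize p ^ (b + 1) = y at *
  constructor
  · field_simp; ring
  · field_simp; ring

lemma binom_rec (L : ℕ) (k : ℤ) :
    qBinom (Xq ^ 2) (2 * ((L + 1 : ℕ) : ℤ)) (k + 1)
      = (Xq ^ 2) ^ (2 * (L : ℤ) + 1 - k) * qBinom (Xq ^ 2) (2 * (L : ℤ)) (k - 1)
        + (1 + (Xq ^ 2) ^ (2 * (L : ℤ) + 1)) * qBinom (Xq ^ 2) (2 * (L : ℤ)) k
        + (Xq ^ 2) ^ (k + 1) * qBinom (Xq ^ 2) (2 * (L : ℤ)) (k + 1) := by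
  have h1 := (pascal (2 * L + 1) (k + 1)).1
  have h2 := (pascal (2 * L) k).2
  have h3 := (pascal (2 * L) (k + 1)).2
  push_cast at h1 h2 h3
  have hX : (Xq ^ 2 : RatFunc ℚ) ≠ 0 := pow_ne_zero _ Xq_ne
  generalize (Xq ^ 2 : RatFunc ℚ) = p at *
  rw [show 2 * ((L + 1 : ℕ) : ℤ) = 2 * (L : ℤ) + 1 + 1 by push_cast; ring, h1,
    show k + 1 - 1 = k by ring, h2, h3, show k + 1 - 1 = k by ring]
  have : p ^ (2 * (L : ℤ) + 1) = p ^ (k + 1) * p ^ (2 * (L : ℤ) + 1 - (k + 1)) := by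
    rw [← zpow_add₀ hX]; congr 1; ring
  rw [this]; ring

noncomputable def FF (L : ℕ) (j : ℤ) : RatFunc ℚ :=
  (-1 : RatFunc ℚ) ^ j * Xq ^ (j ^ 2) * qBinom (Xq ^ 2) (2 * L) ((L : ℤ) + j)

lemma FF_out (L : ℕ) (j : ℤ) (h : j ∉ Finset.Icc (-(L : ℤ)) L) : FF L j = 0 := by
  rw [FF, qBinom_out, mul_zero]
  simp at h
  intro h'
  have := h (by omega)
  omega

lemma FF_rec (L : ℕ) (j : ℤ) :
    FF (L + 1) j = (1 + Xq ^ (4 * L + 2)) * FF L j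
      - Xq ^ (2 * L + 1) * (FF L (j - 1) + FF L (j + 1)) := by
  have hX := Xq_ne
  unfold FF
  rw [show ((L + 1 : ℕ) : ℤ) + j = (L + j) + 1 by push_cast; ring, binom_rec,
    show (L : ℤ) + (j - 1) = L + j - 1 by ring, show (L : ℤ) + (j + 1) = L + j + 1 by ring]
  have m1 : (-1 : RatFunc ℚ) ^ (j - 1) = - (-1) ^ j := by
    rw [zpow_sub_one₀ (by norm_num)]; norm_num
  have m2 : (-1 : RatFunc ℚ) ^ (j + 1) = - (-1) ^ j := by
    rw [zpow_add_one₀ (by norm_num)]; norm_num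
  rw [m1, m2]
  have z (e : ℤ) : (Xq ^ 2) ^ e = Xq ^ (2 * e) := by
    rw [zpow_mul]; norm_cast
  rw [z, z, z, ← zpow_natCast Xq (4 * L + 2), ← zpow_natCast Xq (2 * L + 1)]
  have a1 : Xq ^ (j ^ 2) * Xq ^ (2 * (2 * (L : ℤ) + 1 - (L + j)))
      = Xq ^ (((2 * L + 1 : ℕ)) : ℤ) * Xq ^ ((j - 1) ^ 2) := by
    rw [← zpow_add₀ hX, ← zpow_add₀ hX]; congr 1; push_cast; ring
  have a2 : Xq ^ (j ^ 2) * Xq ^ (2 * ((L : ℤ) + j + 1))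
      = Xq ^ (((2 * L + 1 : ℕ)) : ℤ) * Xq ^ ((j + 1) ^ 2) := by
    rw [← zpow_add₀ hX, ← zpow_add₀ hX]; congr 1; push_cast; ring
  have a3 : 2 * (2 * (L : ℤ) + 1) = ((4 * L + 2 : ℕ) : ℤ) := by push_cast; ring
  rw [a3]
  linear_combination (-1 : RatFunc ℚ) ^ j * qBinom (Xq ^ 2) (2 * L) (L + j - 1) * a1
    + (-1 : RatFunc ℚ) ^ j * qBinom (Xq ^ 2) (2 * L) (L + j + 1) * a2

lemma shift_sum (f : ℤ → RatFunc ℚ) (L : ℕ) (s : ℤ) (hs : -1 ≤ s ∧ s ≤ 1)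
    (hf : ∀ j, j ∉ Finset.Icc (-(L : ℤ)) L → f j = 0) :
    ∑ j ∈ Finset.Icc (-((L + 1 : ℕ) : ℤ)) ((L + 1 : ℕ) : ℤ), f (j + s)
      = ∑ j ∈ Finset.Icc (-(L : ℤ)) L, f j := by
  rw [← finsum_eq_sum_of_support_subset, ← finsum_eq_sum_of_support_subset]
  · exact finsum_comp_equiv (Equiv.addRight s)
  · intro j hj
    by_contra h
    exact hj (hf j (by simpa using h))
  · intro j hj
    by_contra h
    refine hj (hf _ ?_)
    simp only [Finset.coe_Icc, Set.mem_Icc, Finset.mem_Icc] at h ⊢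
    push_cast at h
    omega

lemma leg3_rel (j : ℤ) : leg3 (j + 1 + 1) + leg3 (j - 1 + 1) = - leg3 (j + 1) := by
  unfold leg3
  split_ifs <;> omega

lemma sum_rec (L : ℕ) :
    ∑ j ∈ Finset.Icc (-((L + 1 : ℕ) : ℤ)) ((L + 1 : ℕ) : ℤ),
        (leg3 (j + 1) : RatFunc ℚ) * FF (L + 1) j
      = (1 + Xq ^ (2 * L + 1) + Xq ^ (4 * L + 2)) *
        ∑ j ∈ Finset.Icc (-(L : ℤ)) L, (leg3 (j + 1) : RatFunc ℚ) * FF L j := by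
  have s0 := shift_sum (fun j => (leg3 (j + 1) : RatFunc ℚ) * FF L j) L 0 (by norm_num)
    (fun j hj => by simp [FF_out L j hj])
  have s1 := shift_sum (fun j => (leg3 (j + 1 + 1) : RatFunc ℚ) * FF L j) L (-1) (by norm_num)
    (fun j hj => by simp [FF_out L j hj])
  have s2 := shift_sum (fun j => (leg3 (j - 1 + 1) : RatFunc ℚ) * FF L j) L 1 (by norm_num)
    (fun j hj => by simp [FF_out L j hj])
  have s3 : ∑ j ∈ Finset.Icc (-(L : ℤ)) L, (leg3 (j + 1 + 1) : RatFunc ℚ) * FF L j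
      + ∑ j ∈ Finset.Icc (-(L : ℤ)) L, (leg3 (j - 1 + 1) : RatFunc ℚ) * FF L j
      = - ∑ j ∈ Finset.Icc (-(L : ℤ)) L, (leg3 (j + 1) : RatFunc ℚ) * FF L j := by
    rw [← Finset.sum_add_distrib, ← Finset.sum_neg_distrib]
    refine Finset.sum_congr rfl fun j _ => ?_
    have : (leg3 (j + 1 + 1) : RatFunc ℚ) + leg3 (j - 1 + 1) = - leg3 (j + 1) := by
      exact_mod_cast congrArg (Int.cast : ℤ → RatFunc ℚ) (leg3_rel j)
    rw [← add_mul, this, neg_mul]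
  have key : ∑ j ∈ Finset.Icc (-((L + 1 : ℕ) : ℤ)) ((L + 1 : ℕ) : ℤ),
        (leg3 (j + 1) : RatFunc ℚ) * FF (L + 1) j
      = (1 + Xq ^ (4 * L + 2)) * ∑ j ∈ Finset.Icc (-((L + 1 : ℕ) : ℤ)) ((L + 1 : ℕ) : ℤ),
          (leg3 (j + 0 + 1) : RatFunc ℚ) * FF L (j + 0)
        - Xq ^ (2 * L + 1) * (∑ j ∈ Finset.Icc (-((L + 1 : ℕ) : ℤ)) ((L + 1 : ℕ) : ℤ),
          (leg3 (j + -1 + 1 + 1) : RatFunc ℚ) * FF L (j + -1)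
        + ∑ j ∈ Finset.Icc (-((L + 1 : ℕ) : ℤ)) ((L + 1 : ℕ) : ℤ),
          (leg3 (j + 1 - 1 + 1) : RatFunc ℚ) * FF L (j + 1)) := by
    rw [← Finset.sum_add_distrib, Finset.mul_sum, Finset.mul_sum, ← Finset.sum_sub_distrib]
    refine Finset.sum_congr rfl fun j _ => ?_
    rw [FF_rec, add_zero, neg_add_cancel_right, add_sub_cancel_right, ← sub_eq_add_neg]
    ring
  rw [key, s0, s1, s2, s3]
  ring

lemma main_aux (L : ℕ) :
    ∑ j ∈ Finset.Icc (-(L : ℤ)) L, (leg3 (j + 1) : RatFunc ℚ) * FF L j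
      = qPoch (Xq ^ 3) (Xq ^ 6) L / qPoch Xq (Xq ^ 2) L := by
  induction L with
  | zero => simp [FF, qPoch_zero, qBinom, leg3]
  | succ L ih =>
    rw [sum_rec, ih]
    have h1 := O_ne L
    have h2 := O_ne (L + 1)
    rw [qPoch_succ] at h2 ⊢
    rw [qPoch_succ]
    have h3 := right_ne_zero_of_mul h2
    rw [mul_div_assoc', div_eq_div_iff h1 h2]
    ring

/-- Theorem 2.4: for `L ≥ 0`,
`∑_j (-1)^j q^{j²} ((j+1)/3) [2L choose L+j]_{q²} = (q³;q⁶)_L/(q;q²)_L`.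
The sum is taken over `-L ≤ j ≤ L`, which covers all nonzero terms. -/
theorem statement9 (L : ℕ) :
    ∑ j ∈ Finset.Icc (-(L : ℤ)) (L : ℤ),
      (-1 : RatFunc ℚ) ^ j * Xq ^ (j ^ 2) * (leg3 (j + 1) : RatFunc ℚ) *
        qBinom (Xq ^ 2) (2 * L) ((L : ℤ) + j) =
    qPoch (Xq ^ 3) (Xq ^ 6) L / qPoch Xq (Xq ^ 2) L := by
  rw [← main_aux]
  refine Finset.sum_congr rfl fun j _ => ?_
  rw [FF]
  ring
end

section
/- For every non-negative integer L, \(\sum_{j=-\infty}^{\infty} (-1)^j \left(\frac{j}{3}\right) q^{j^2} \binom{2L+1}{L-j}_{q^2} = q^{1+2L}\, \frac{(q^3;q^6)_L}{(q;q^2)_L}\). The sum is finite since the q-binomial coefficient vanishes for j < -(L+1) and j > L. -/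
open Finset

lemma one_sub_Xq_pow (m : ℕ) (hm : m ≠ 0) : (1 : RatFunc ℚ) - Xq ^ m ≠ 0 := by
  intro h
  have h1 : (algebraMap (Polynomial ℚ) (RatFunc ℚ)) (1 - Polynomial.X ^ m) = 0 := by
    rw [map_sub, map_one, map_pow, RatFunc.algebraMap_X]
    exact h
  have h2 : (1 - Polynomial.X ^ m : Polynomial ℚ) = 0 :=
    RatFunc.algebraMap_injective ℚ (by rw [h1, map_zero])
  have h3 := congrArg (Polynomial.eval 0) h2
  simp [hm] at h3

noncomputable def PP (n : ℕ) : RatFunc ℚ := qPoch (Xq ^ 2) (Xq ^ 2) n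

lemma PP_succ (n : ℕ) : PP (n + 1) = PP n * (1 - Xq ^ (2 * n + 2)) := by
  unfold PP qPoch
  rw [Finset.prod_range_succ]
  ring

lemma PP_ne (n : ℕ) : PP n ≠ 0 := by
  induction n with
  | zero => simp [PP, qPoch]
  | succ n ih =>
    rw [PP_succ]
    exact mul_ne_zero ih (one_sub_Xq_pow _ (by omega))

noncomputable def BB (n k : ℕ) : RatFunc ℚ := if k ≤ n then PP n / (PP k * PP (n - k)) else 0

lemma BB_zero (n : ℕ) : BB n 0 = 1 := by
  have h0 : PP 0 = 1 := by simp [PP, qPoch]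
  simp [BB, h0, PP_ne]

lemma BB_gt (n k : ℕ) (h : n < k) : BB n k = 0 := by
  simp [BB, h]

lemma BB_self (n : ℕ) : BB n n = 1 := by
  have h0 : PP 0 = 1 := by simp [PP, qPoch]
  simp [BB, h0, PP_ne]

lemma BB_pascal (k d : ℕ) :
    BB (k + d + 1) (k + 1) = BB (k + d) (k + 1) + Xq ^ (2 * d) * BB (k + d) k := by
  rcases d with _ | d
  · simp only [Nat.add_zero]; rw [BB_self (k + 1), BB_self k, BB_gt _ _ (by omega)]; simp
  · have e1 : k + (d + 1) + 1 - (k + 1) = d + 1 := by omega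
    have e2 : k + (d + 1) - (k + 1) = d := by omega
    have e3 : k + (d + 1) - k = d + 1 := by omega
    unfold BB
    rw [if_pos (by omega), if_pos (by omega), if_pos (by omega), e1, e2, e3,
      PP_succ (k + (d + 1)), PP_succ k, PP_succ d]
    have a1 := PP_ne k
    have a2 := PP_ne d
    have a3 := one_sub_Xq_pow (2 * k + 2) (by omega)
    have a4 := one_sub_Xq_pow (2 * d + 2) (by omega)
    generalize PP (k + (d + 1)) = N
    have e5 : (Xq : RatFunc ℚ) ^ (2 * (k + (d + 1)) + 2)
        = Xq ^ (2 * k + 2) * Xq ^ (2 * d + 2) := by ring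
    have e6 : (Xq : RatFunc ℚ) ^ (2 * (d + 1)) = Xq ^ (2 * d + 2) := by ring
    rw [e5, e6]
    generalize (Xq : RatFunc ℚ) ^ (2 * k + 2) = u at *
    generalize (Xq : RatFunc ℚ) ^ (2 * d + 2) = v at *
    field_simp
    ring

section
variable {F : Type*} [Field F] (φ : RatFunc ℚ →+* F)

lemma qbin_thm (x : F) (n : ℕ) :
    ∏ i ∈ Finset.range n, (1 - x * φ Xq ^ (2 * i)) =
    ∑ k ∈ Finset.range (n + 1), (-x) ^ k * φ Xq ^ (k * (k - 1)) * φ (BB n k) := by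
  induction n with
  | zero => simp [BB_zero]
  | succ n ih =>
    rw [Finset.prod_range_succ, ih, Finset.sum_range_succ' _ (n + 1), mul_sub, mul_one]
    have key : ∀ k ∈ Finset.range (n + 1),
        (-x) ^ (k + 1) * φ Xq ^ ((k + 1) * (k + 1 - 1)) * φ (BB (n + 1) (k + 1)) =
        (-x) ^ (k + 1) * φ Xq ^ ((k + 1) * (k + 1 - 1)) * φ (BB n (k + 1))
        - ((-x) ^ k * φ Xq ^ (k * (k - 1)) * φ (BB n k)) * (x * φ Xq ^ (2 * n)) := by
      intro k hk
      obtain ⟨d, rfl⟩ : ∃ d, n = k + d := ⟨n - k, by have := Finset.mem_range.1 hk; omega⟩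
      rw [BB_pascal, map_add, map_mul, map_pow]
      have e : φ Xq ^ ((k + 1) * (k + 1 - 1)) = φ Xq ^ (k * (k - 1)) * φ Xq ^ (2 * k) := by
        rw [← pow_add]; congr 1
        rcases k with _ | k
        · rfl
        · simp only [Nat.add_sub_cancel]; ring
      rw [e]
      ring
    rw [Finset.sum_congr rfl key, Finset.sum_sub_distrib, ← Finset.sum_mul]
    have h2 := Finset.sum_range_succ'
      (fun k => (-x) ^ k * φ Xq ^ (k * (k - 1)) * φ (BB n k)) (n + 1)
    rw [Finset.sum_range_succ, BB_gt n (n + 1) (by omega)] at h2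
    simp only [map_zero, mul_zero, add_zero] at h2
    rw [h2]
    simp only [BB_zero]
    ring

noncomputable def RR (L : ℕ) : RatFunc ℚ :=
  ∏ k ∈ Finset.range L, (1 + Xq ^ (2 * k + 1) + Xq ^ (2 * (2 * k + 1)))

lemma RR_eq (L : ℕ) : qPoch (Xq ^ 3) (Xq ^ 6) L / qPoch Xq (Xq ^ 2) L = RR L := by
  unfold qPoch RR
  rw [← Finset.prod_div_distrib]
  refine Finset.prod_congr rfl fun k _ => ?_
  have h := one_sub_Xq_pow (2 * k + 1) (by omega)
  have e : 1 - Xq * (Xq ^ 2) ^ k = 1 - Xq ^ (2 * k + 1) := by ring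
  rw [e, div_eq_iff h]
  ring

lemma prod_eval (z : F) (hz : z ^ 2 + z + 1 = 0) (L : ℕ) :
    ∏ i ∈ Finset.range (2 * L + 1), (1 - z * φ Xq ^ (1 - 2 * (L : ℤ) + 2 * i)) =
    (-z) ^ L * φ Xq ^ (-(L : ℤ) ^ 2) * φ (RR L) * (1 - z * φ Xq ^ (2 * L + 1)) := by
  have hq : φ Xq ≠ 0 := by simpa using Xq_ne
  induction L with
  | zero => simp [RR]
  | succ L ih =>
    rw [show 2 * (L + 1) + 1 = (2 * L + 1) + 1 + 1 by ring, Finset.prod_range_succ',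
      Finset.prod_range_succ]
    have e : ∀ i : ℕ, (1 - 2 * ((L + 1 : ℕ) : ℤ) + 2 * ((i + 1 : ℕ) : ℤ))
        = 1 - 2 * (L : ℤ) + 2 * i := by intro i; push_cast; ring
    simp only [e]
    rw [ih]
    have e1 : (1 - 2 * (L : ℤ) + 2 * ((2 * L + 1 : ℕ) : ℤ)) = ((2 * L + 3 : ℕ) : ℤ) := by
      push_cast; ring
    have e2 : (1 - 2 * ((L + 1 : ℕ) : ℤ) + 2 * ((0 : ℕ) : ℤ)) = -((2 * L + 1 : ℕ) : ℤ) := by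
      push_cast; ring
    have e3 : (-((L + 1 : ℕ) : ℤ) ^ 2) = -(L : ℤ) ^ 2 + -((2 * L + 1 : ℕ) : ℤ) := by
      push_cast; ring
    have e4 : RR (L + 1) = RR L * (1 + Xq ^ (2 * L + 1) + Xq ^ (2 * (2 * L + 1))) := by
      unfold RR; rw [Finset.prod_range_succ]
    rw [e1, e2, e3, e4, zpow_add₀ hq, zpow_neg _ ((2 * L + 1 : ℕ) : ℤ), zpow_natCast,
      zpow_natCast]
    simp only [map_mul, map_add, map_pow, map_one]
    rw [show 2 * L + 1 + 1 + 1 = 2 * L + 3 by ring, pow_mul', pow_succ (-z)]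
    have hm : φ Xq ^ (2 * L + 1) ≠ 0 := pow_ne_zero _ hq
    generalize φ Xq ^ (2 * L + 1) = u at *
    have : (1 - z * u) * (1 - z * u⁻¹) = -z * u⁻¹ * (1 + u + u ^ 2) := by
      field_simp
      linear_combination u * hz
    linear_combination (-z) ^ L * φ Xq ^ (-(L : ℤ) ^ 2) * φ (RR L)
      * (1 - z * φ Xq ^ (2 * L + 3)) * this

lemma T_eval (z : F) (hz : z ^ 2 + z + 1 = 0) (L : ℕ) :
    ∑ k ∈ Finset.range (2 * L + 2),
      (-z) ^ k * φ Xq ^ (((L : ℤ) - k) ^ 2) * φ (BB (2 * L + 1) k) =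
    (-z) ^ L * φ (RR L) * (1 - z * φ Xq ^ (2 * L + 1)) := by
  have hq : φ Xq ≠ 0 := by simpa using Xq_ne
  have h := prod_eval φ z hz L
  have h1 := qbin_thm φ (z * φ Xq ^ (1 - 2 * (L : ℤ))) (2 * L + 1)
  have h2 : ∏ i ∈ Finset.range (2 * L + 1), (1 - z * φ Xq ^ (1 - 2 * (L : ℤ) + 2 * i)) =
      ∏ i ∈ Finset.range (2 * L + 1), (1 - z * φ Xq ^ (1 - 2 * (L : ℤ)) * φ Xq ^ (2 * i)) := by
    refine Finset.prod_congr rfl fun i _ => ?_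
    rw [zpow_add₀ hq, mul_assoc]
    norm_cast
  rw [h2, h1] at h
  have h3 : ∑ k ∈ Finset.range (2 * L + 2),
      (-z) ^ k * φ Xq ^ (((L : ℤ) - k) ^ 2) * φ (BB (2 * L + 1) k) =
      φ Xq ^ ((L : ℤ) ^ 2) * ∑ k ∈ Finset.range (2 * L + 1 + 1),
      (-(z * φ Xq ^ (1 - 2 * (L : ℤ)))) ^ k * φ Xq ^ (k * (k - 1)) * φ (BB (2 * L + 1) k) := by
    rw [Finset.mul_sum]
    refine Finset.sum_congr rfl fun k _ => ?_
    have e : φ Xq ^ (((L : ℤ) - k) ^ 2) =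
        φ Xq ^ ((L : ℤ) ^ 2) * (φ Xq ^ (1 - 2 * (L : ℤ))) ^ k * φ Xq ^ (k * (k - 1)) := by
      rw [← zpow_natCast (φ Xq ^ (1 - 2 * (L : ℤ))), ← zpow_natCast (φ Xq) (k * (k - 1)),
        ← zpow_mul, ← zpow_add₀ hq, ← zpow_add₀ hq]
      congr 1
      rcases k with _ | k
      · simp
      · simp only [Nat.add_sub_cancel]; push_cast; ring
    rw [e, ← neg_mul, mul_pow]
    ring
  rw [h3, h, zpow_neg]
  have : φ Xq ^ ((L : ℤ) ^ 2) ≠ 0 := zpow_ne_zero _ hq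
  field_simp

lemma leg_eq (w : F) (hw : w ^ 2 + w + 1 = 0) (j : ℤ) :
    (w - w ^ 2) * ((leg3 j : ℤ) : F) = w ^ j - (w ^ 2) ^ j := by
  have h3 : w ^ 3 = 1 := by linear_combination (w - 1) * hw
  have h0 : w ≠ 0 := by rintro rfl; simp at hw
  have hz : ∀ m : ℤ, w ^ (3 * m) = 1 := by
    intro m; rw [zpow_mul]; norm_cast; rw [h3]; simp
  have hz2 : ∀ m : ℤ, (w ^ 2) ^ (3 * m) = 1 := by
    intro m; rw [zpow_mul]; norm_cast; rw [← pow_mul, pow_mul' w 2 3, h3]; simp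
  have hd := Int.emod_add_mul_ediv j 3
  have hj : j % 3 = 0 ∨ j % 3 = 1 ∨ j % 3 = 2 := by omega
  have e : w ^ j - (w ^ 2) ^ j = w ^ (j % 3) - (w ^ 2) ^ (j % 3) := by
    conv_lhs => rw [← hd]
    rw [zpow_add₀ h0, zpow_add₀ (pow_ne_zero 2 h0), hz, hz2]; simp
  rw [e]
  unfold leg3
  rcases hj with h | h | h <;> rw [h]
  · simp
  · simp
  · norm_num
    norm_cast
    linear_combination -w * h3

lemma qBinom_eq (L k : ℕ) (hk : k < 2 * L + 2) :
    qBinom (Xq ^ 2) (2 * L + 1) (k : ℤ) = BB (2 * L + 1) k := by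
  unfold qBinom BB
  rw [if_pos (by omega), if_pos (by omega)]
  have e1 : (2 * (L : ℤ) + 1).toNat = 2 * L + 1 := by omega
  have e2 : (2 * (L : ℤ) + 1 - k).toNat = 2 * L + 1 - k := by omega
  rw [e1, e2, Int.toNat_natCast]
  rfl

lemma main_F (w : F) (hw : w ^ 2 + w + 1 = 0) (L : ℕ) :
    (w - w ^ 2) * φ (∑ k ∈ Finset.range (2 * L + 2),
      (-1 : RatFunc ℚ) ^ ((L : ℤ) - k) * (leg3 ((L : ℤ) - k) : RatFunc ℚ) *
        Xq ^ (((L : ℤ) - k) ^ 2) * BB (2 * L + 1) k) =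
    (w - w ^ 2) * φ (Xq ^ (1 + 2 * L) * RR L) := by
  have h3 : w ^ 3 = 1 := by linear_combination (w - 1) * hw
  have h0 : w ≠ 0 := by rintro rfl; simp at hw
  have hw2 : (w ^ 2) ^ 2 + w ^ 2 + 1 = 0 := by linear_combination hw + w * h3
  have t1 := T_eval φ w hw L
  have t2 := T_eval φ (w ^ 2) hw2 L
  have hinv : w⁻¹ = w ^ 2 := by field_simp; linear_combination -h3
  have hinv2 : (w ^ 2)⁻¹ = w := by rw [← hinv, inv_inv]
  have key : (w - w ^ 2) * φ (∑ k ∈ Finset.range (2 * L + 2),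
      (-1 : RatFunc ℚ) ^ ((L : ℤ) - k) * (leg3 ((L : ℤ) - k) : RatFunc ℚ) *
        Xq ^ (((L : ℤ) - k) ^ 2) * BB (2 * L + 1) k) =
      (-w) ^ L * (∑ k ∈ Finset.range (2 * L + 2),
      (-w ^ 2) ^ k * φ Xq ^ (((L : ℤ) - k) ^ 2) * φ (BB (2 * L + 1) k)) -
      (-w ^ 2) ^ L * (∑ k ∈ Finset.range (2 * L + 2),
      (-w) ^ k * φ Xq ^ (((L : ℤ) - k) ^ 2) * φ (BB (2 * L + 1) k)) := by
    rw [map_sum, Finset.mul_sum, Finset.mul_sum, Finset.mul_sum, ← Finset.sum_sub_distrib]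
    refine Finset.sum_congr rfl fun k _ => ?_
    simp only [map_mul, map_zpow₀, map_neg, map_one, map_intCast]
    have l := leg_eq w hw ((L : ℤ) - k)
    have z1 : w ^ ((L : ℤ) - k) = w ^ L * (w ^ 2) ^ k := by
      rw [zpow_sub₀ h0, zpow_natCast, zpow_natCast, div_eq_mul_inv, ← inv_pow, hinv]
    have z2 : (w ^ 2) ^ ((L : ℤ) - k) = (w ^ 2) ^ L * w ^ k := by
      rw [zpow_sub₀ (pow_ne_zero 2 h0), zpow_natCast, zpow_natCast, div_eq_mul_inv, ← inv_pow,
        hinv2]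
    have z3 : (-1 : F) ^ ((L : ℤ) - k) = (-1) ^ L * (-1) ^ k := by
      rw [zpow_sub₀ (by norm_num), zpow_natCast, zpow_natCast, div_eq_mul_inv, ← inv_pow]
      norm_num
    rw [z1, z2] at l
    rw [z3, neg_pow w, neg_pow w, neg_pow (w ^ 2), neg_pow (w ^ 2)]
    linear_combination (-1) ^ L * (-1) ^ k * φ Xq ^ (((L : ℤ) - k) ^ 2) *
      φ (BB (2 * L + 1) k) * l
  rw [key, t1, t2]
  have hp : (-w) ^ L * (-w ^ 2) ^ L = 1 := by
    rw [← mul_pow, show -w * -w ^ 2 = w ^ 3 by ring, h3, one_pow]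
  simp only [map_mul, map_pow]
  linear_combination (φ (RR L) * (w - w ^ 2) * φ Xq ^ (2 * L + 1)) * hp

end

/-- Theorem 2.6: for `L ≥ 0`,
`∑_j (-1)^j (j/3) q^{j²} [2L+1 choose L-j]_{q²} = q^{1+2L} (q³;q⁶)_L/(q;q²)_L`.
The sum is taken over `-(L+1) ≤ j ≤ L`, which covers all nonzero terms. -/
theorem statement11 (L : ℕ) :
    ∑ j ∈ Finset.Icc (-(L : ℤ) - 1) (L : ℤ),
      (-1 : RatFunc ℚ) ^ j * (leg3 j : RatFunc ℚ) * Xq ^ (j ^ 2) *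
        qBinom (Xq ^ 2) (2 * L + 1) ((L : ℤ) - j) =
    Xq ^ (1 + 2 * L) * (qPoch (Xq ^ 3) (Xq ^ 6) L / qPoch Xq (Xq ^ 2) L) := by
  rw [RR_eq]
  have hs : ∑ j ∈ Finset.Icc (-(L : ℤ) - 1) (L : ℤ),
      (-1 : RatFunc ℚ) ^ j * (leg3 j : RatFunc ℚ) * Xq ^ (j ^ 2) *
        qBinom (Xq ^ 2) (2 * L + 1) ((L : ℤ) - j) =
      ∑ k ∈ Finset.range (2 * L + 2),
      (-1 : RatFunc ℚ) ^ ((L : ℤ) - k) * (leg3 ((L : ℤ) - k) : RatFunc ℚ) *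
        Xq ^ (((L : ℤ) - k) ^ 2) * BB (2 * L + 1) k := by
    symm
    refine Finset.sum_bij (fun k _ => (L : ℤ) - k) ?_ ?_ ?_ ?_
    · intro k hk
      have := Finset.mem_range.1 hk
      rw [Finset.mem_Icc]; omega
    · intro a _ b _ h
      omega
    · intro j hj
      rw [Finset.mem_Icc] at hj
      exact ⟨((L : ℤ) - j).toNat, by rw [Finset.mem_range]; omega, by omega⟩
    · intro k hk
      rw [← qBinom_eq L k (Finset.mem_range.1 hk), sub_sub_cancel]
  rw [hs]
  let φ := algebraMap (RatFunc ℚ) (AlgebraicClosure (RatFunc ℚ))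
  obtain ⟨s, hs⟩ := IsAlgClosed.exists_pow_nat_eq (-3 : AlgebraicClosure (RatFunc ℚ))
    (n := 2) (by norm_num)
  have hw : ((s - 1) / 2) ^ 2 + (s - 1) / 2 + 1 = 0 := by
    linear_combination hs / 4
  have hne : ((s - 1) / 2) - ((s - 1) / 2) ^ 2 ≠ 0 := by
    have e : ((s - 1) / 2) - ((s - 1) / 2) ^ 2 = s := by linear_combination -hs / 4
    rw [e]
    rintro rfl
    norm_num at hs
  exact φ.injective (mul_left_cancel₀ hne (main_F φ _ hw L))
end
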